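/- Sampling estimate: Let s > 1 and A ∈ C⁰([−τ₀,τ₀], H^s(ℝ²)). For ε ∈ (0,1] and t ∈ [−ε^{-3}τ₀, ε^{-3}τ₀] define the sequence a_{m,n}(t) := A(ε(m−t), ε²n, ε³t) for (m,n) ∈ ℤ². Then there exists a constant C_s > 0, depending only on s, such that for all ε ∈ (0,1] and all t ∈ [−ε^{-3}τ₀, ε^{-3}τ₀], ‖a(t)‖_{ℓ²(ℤ²)} ≤ C_s ε^{-3/2} ‖A(·,·,ε³t)‖_{H^s(ℝ²)}. Consequently, in Fourier space, ‖â(·,·,t)‖_{L²(𝕋²)} ≤ C_s ε^{-3/2} ‖⟨·⟩^s Â(·,·,ε³t)‖_{L²(ℝ²)}, where â(k,l,t) = (1/2π)Σ_{(m,n)∈ℤ²} a_{m,n}(t) e^{ikm+iln} on 𝕋² = [−π,π)². -/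

import Mathlib

open MeasureTheory Set

noncomputable section

/-- The torus `𝕋² = [-π, π)²` as a subset of `ℝ²`. -/
def T2 : Set (ℝ × ℝ) := Ico (-Real.pi) Real.pi ×ˢ Ico (-Real.pi) Real.pi

/-- The weighted `L²` norm `‖⟨·⟩ˢ g‖_{L²(ℝ²)}` (of a Fourier transform `g`),
i.e. the `Hˢ(ℝ²)` norm of the underlying function. -/
def wL2 (s : ℝ) (g : ℝ × ℝ → ℂ) : ℝ :=
  (∫ ξ : ℝ × ℝ, (1 + ξ.1 ^ 2 + ξ.2 ^ 2) ^ s * ‖g ξ‖ ^ 2) ^ ((1 : ℝ) / 2)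

/-- Membership in `Hˢ(ℝ²)`, expressed through the Fourier transform `g`. -/
def MemHs (s : ℝ) (g : ℝ × ℝ → ℂ) : Prop :=
  Integrable fun ξ : ℝ × ℝ => (1 + ξ.1 ^ 2 + ξ.2 ^ 2) ^ s * ‖g ξ‖ ^ 2

/-- `C⁰(I, Hˢ(ℝ²))`: membership in `Hˢ` for every time in `I`, together with continuity
in the `Hˢ` norm, expressed through the time-dependent Fourier transform `g`. -/
def ContInHsOn (s : ℝ) (I : Set ℝ) (g : ℝ × ℝ → ℝ → ℂ) : Prop :=
  (∀ T ∈ I, MemHs s fun ξ => g ξ T) ∧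
  ∀ T ∈ I, ∀ δ > (0 : ℝ), ∃ η > (0 : ℝ), ∀ T' ∈ I, |T' - T| < η →
    wL2 s (fun ξ => g ξ T' - g ξ T) < δ

/-- The `ℓ²(ℤ²)` norm of a complex sequence. -/
def l2Z (a : ℤ × ℤ → ℂ) : ℝ := (∑' p : ℤ × ℤ, ‖a p‖ ^ 2) ^ ((1 : ℝ) / 2)

/-- one-dimensional weight -/
def vw (s x : ℝ) : ENNReal := ENNReal.ofReal ((1 + x ^ 2) ^ (-(s / 2)))

lemma vw_measurable (s : ℝ) : Measurable (vw s) := by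
  unfold vw
  fun_prop

lemma vw_anti {s : ℝ} (hs : 1 < s) {x y : ℝ} (h : x ^ 2 ≤ y ^ 2) : vw s y ≤ vw s x := by
  unfold vw
  apply ENNReal.ofReal_le_ofReal
  exact Real.rpow_le_rpow_of_nonpos (by positivity) (by linarith) (by linarith)

def K0 (s : ℝ) : ENNReal := ∑' n : ℤ, vw s n

lemma K0_ne_top {s : ℝ} (hs : 1 < s) : K0 s ≠ ⊤ := by
  have h : Summable fun n : ℤ => (1 + (n : ℝ) ^ 2) ^ (-(s / 2)) := by
    refine Summable.of_norm_bounded_eventually (Real.summable_abs_int_rpow hs) ?_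
    have : ({0} : Set ℤ)ᶜ ∈ Filter.cofinite := (Set.finite_singleton 0).compl_mem_cofinite
    filter_upwards [this] with n hn
    have hn' : (n : ℝ) ≠ 0 := by simpa using hn
    have hp : 0 < |(n : ℝ)| := abs_pos.mpr hn'
    rw [Real.norm_of_nonneg (by positivity)]
    have e : |(n : ℝ)| ^ (-s) = ((n : ℝ) ^ 2) ^ (-(s / 2)) := by
      rw [← sq_abs (n : ℝ), ← Real.rpow_natCast, ← Real.rpow_mul hp.le]
      congr 1
      push_cast
      ring
    rw [e]
    exact Real.rpow_le_rpow_of_nonpos (by positivity) (by linarith) (by linarith)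
  unfold K0 vw
  exact h.tsum_ofReal_ne_top

lemma one_dim {s : ℝ} (hs : 1 < s) (f : ℝ → ENNReal) (hf : Measurable f)
    (hper : ∀ x, ∀ n : ℤ, f (x + n * (2 * Real.pi)) = f x) :
    ∫⁻ x, vw s x * f x ≤ K0 s * ∫⁻ x in Ico (-Real.pi) Real.pi, f x := by
  have hpi := Real.pi_pos
  have h2 : (0 : ℝ) < 2 * Real.pi := by positivity
  rw [← setLIntegral_univ, ← iUnion_Ico_add_zsmul h2 (-Real.pi),
    lintegral_iUnion (fun _ => measurableSet_Ico) (pairwise_disjoint_Ico_add_zsmul _ _)]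
  unfold K0
  rw [← ENNReal.tsum_mul_right]
  refine ENNReal.tsum_le_tsum fun n => ?_
  have mp := measurePreserving_add_right (volume : Measure ℝ) (n * (2 * Real.pi))
  have e := mp.setLIntegral_comp_preimage
    (s := Ico (-Real.pi + n • (2 * Real.pi)) (-Real.pi + (n + 1) • (2 * Real.pi)))
    measurableSet_Ico ((vw_measurable s).mul hf)
  simp only [Pi.mul_apply] at e
  rw [← e]
  have hset : (fun x : ℝ => x + n * (2 * Real.pi)) ⁻¹'
      Ico (-Real.pi + n • (2 * Real.pi)) (-Real.pi + (n + 1) • (2 * Real.pi))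
      = Ico (-Real.pi) Real.pi := by
    ext x
    simp only [mem_preimage, mem_Ico, zsmul_eq_mul]
    push_cast
    constructor <;> rintro ⟨h1, h2⟩ <;> constructor <;> linarith
  rw [hset, ← lintegral_const_mul _ hf]
  refine setLIntegral_mono (hf.const_mul _) fun x hx => ?_
  rw [hper]
  gcongr
  apply vw_anti hs
  rw [sq_le_sq]
  have hx1 : |x| ≤ Real.pi := abs_le.mpr ⟨hx.1, hx.2.le⟩
  have h3 := Real.pi_gt_three
  by_cases hn : n = 0
  · simp [hn]
  have hn1 : (1 : ℝ) ≤ |(n : ℝ)| := by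
    rw [← Int.cast_abs]
    exact_mod_cast Int.one_le_abs hn
  have t : |(n : ℝ) * (2 * Real.pi)| ≤ |x + n * (2 * Real.pi)| + |x| := by
    have := abs_sub (x + n * (2 * Real.pi)) x
    simpa using this
  rw [abs_mul, abs_of_pos h2] at t
  nlinarith

lemma one_dim_eps {s : ℝ} (hs : 1 < s) (f : ℝ → ENNReal) (hf : Measurable f)
    (hper : ∀ x, ∀ n : ℤ, f (x + n * (2 * Real.pi)) = f x) {e : ℝ} (he : 0 < e) (he1 : e ≤ 1) :
    ∫⁻ x, vw s x * f (e * x) ≤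
      ENNReal.ofReal e⁻¹ * (K0 s * ∫⁻ x in Ico (-Real.pi) Real.pi, f x) := by
  have hmm : Measurable fun y : ℝ => vw s y * f y := (vw_measurable s).mul hf
  calc ∫⁻ x, vw s x * f (e * x) ≤ ∫⁻ x, vw s (e * x) * f (e * x) := by
        refine lintegral_mono fun x => ?_
        gcongr
        apply vw_anti hs
        rw [mul_pow]
        have : e ^ 2 ≤ 1 := by nlinarith
        nlinarith [sq_nonneg x]
    _ = ∫⁻ y, vw s y * f y ∂(Measure.map (e * ·) volume) := by
        rw [lintegral_map hmm (by fun_prop)]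
    _ = ENNReal.ofReal e⁻¹ * ∫⁻ x, vw s x * f x := by
        rw [Real.map_volume_mul_left he.ne', lintegral_smul_measure, abs_of_pos (by positivity)]
        rfl
    _ ≤ _ := by
        gcongr
        exact one_dim hs f hf hper

lemma two_dim {s : ℝ} (hs : 1 < s) (f : ℝ × ℝ → ENNReal) (hf : Measurable f)
    (hper1 : ∀ x y, ∀ n : ℤ, f (x + n * (2 * Real.pi), y) = f (x, y))
    (hper2 : ∀ x y, ∀ n : ℤ, f (x, y + n * (2 * Real.pi)) = f (x, y))
    {e : ℝ} (he : 0 < e) (he1 : e ≤ 1) :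
    ∫⁻ x : ℝ × ℝ, ENNReal.ofReal ((1 + x.1 ^ 2 + x.2 ^ 2) ^ (-s)) * f (e * x.1, e ^ 2 * x.2) ≤
      ENNReal.ofReal (e ^ 3)⁻¹ * (K0 s * K0 s) * ∫⁻ x in T2, f x := by
  have he2 : e ^ 2 ≤ 1 := by nlinarith
  have he2p : 0 < e ^ 2 := by positivity
  have hF : Measurable fun x => ∫⁻ y in Ico (-Real.pi) Real.pi, f (x, y) :=
    hf.lintegral_prod_right'
  have hT : ∫⁻ x in T2, f x = ∫⁻ x in Ico (-Real.pi) Real.pi,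
      ∫⁻ y in Ico (-Real.pi) Real.pi, f (x, y) := by
    unfold T2
    rw [Measure.volume_eq_prod, ← Measure.prod_restrict, lintegral_prod _ hf.aemeasurable]
  calc _ ≤ ∫⁻ x : ℝ × ℝ, vw s x.1 * vw s x.2 * f (e * x.1, e ^ 2 * x.2) := by
        refine lintegral_mono fun x => ?_
        gcongr
        unfold vw
        rw [← ENNReal.ofReal_mul (by positivity)]
        apply ENNReal.ofReal_le_ofReal
        rw [← Real.mul_rpow (by positivity) (by positivity)]
        have : (1 + x.1 ^ 2 + x.2 ^ 2) ^ (-s) = ((1 + x.1 ^ 2 + x.2 ^ 2) ^ 2) ^ (-(s / 2)) := by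
          rw [← Real.rpow_natCast (1 + x.1 ^ 2 + x.2 ^ 2) 2, ← Real.rpow_mul (by positivity)]
          congr 1
          push_cast
          ring
        rw [this]
        refine Real.rpow_le_rpow_of_nonpos (by positivity) ?_ (by linarith)
        nlinarith [sq_nonneg x.1, sq_nonneg x.2, mul_nonneg (sq_nonneg x.1) (sq_nonneg x.2)]
    _ = ∫⁻ x, ∫⁻ y, vw s x * vw s y * f (e * x, e ^ 2 * y) := by
        rw [Measure.volume_eq_prod, lintegral_prod]
        have h1 := vw_measurable s
        fun_prop
    _ = ∫⁻ x, vw s x * ∫⁻ y, vw s y * f (e * x, e ^ 2 * y) := by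
        refine lintegral_congr fun x => ?_
        simp_rw [mul_assoc]
        rw [lintegral_const_mul]
        have h1 := vw_measurable s
        fun_prop
    _ ≤ ∫⁻ x, vw s x * (ENNReal.ofReal (e ^ 2)⁻¹ *
          (K0 s * ∫⁻ y in Ico (-Real.pi) Real.pi, f (e * x, y))) := by
        refine lintegral_mono fun x => ?_
        gcongr
        exact one_dim_eps hs (fun y => f (e * x, y)) (by fun_prop) (fun y n => hper2 _ y n) he2p he2
    _ = ENNReal.ofReal (e ^ 2)⁻¹ * K0 s *
          ∫⁻ x, vw s x * ∫⁻ y in Ico (-Real.pi) Real.pi, f (e * x, y) := by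
        rw [← lintegral_const_mul]
        · refine lintegral_congr fun x => ?_
          ring
        · exact (vw_measurable s).mul (hF.comp (measurable_const_mul e))
    _ ≤ ENNReal.ofReal (e ^ 2)⁻¹ * K0 s * (ENNReal.ofReal e⁻¹ *
          (K0 s * ∫⁻ x in Ico (-Real.pi) Real.pi, ∫⁻ y in Ico (-Real.pi) Real.pi, f (x, y))) := by
        gcongr
        exact one_dim_eps hs (fun x => ∫⁻ y in Ico (-Real.pi) Real.pi, f (x, y)) hF
          (fun x n => by simp_rw [hper1]) he he1
    _ = _ := by
        rw [hT]
        have : (e ^ 3)⁻¹ = (e ^ 2)⁻¹ * e⁻¹ := by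
          rw [← mul_inv]
          congr 1
        rw [this, ENNReal.ofReal_mul (by positivity)]
        ring

/-- the character -/
def ch (p : ℤ × ℤ) (k : ℝ × ℝ) : ℂ :=
  Complex.exp (Complex.I * ((k.1 : ℂ) * (p.1 : ℂ) + (k.2 : ℂ) * (p.2 : ℂ)))

lemma ch_cont (p : ℤ × ℤ) : Continuous (ch p) := by
  unfold ch
  fun_prop

lemma ch_norm (p : ℤ × ℤ) (k : ℝ × ℝ) : ‖ch p k‖ = 1 := by
  unfold ch
  have : Complex.I * ((k.1 : ℂ) * (p.1 : ℂ) + (k.2 : ℂ) * (p.2 : ℂ)) =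
    ((k.1 * p.1 + k.2 * p.2 : ℝ) : ℂ) * Complex.I := by
    push_cast
    ring
  rw [this, Complex.norm_exp_ofReal_mul_I]

lemma ch_per1 (p : ℤ × ℤ) (x y : ℝ) (n : ℤ) : ch p (x + n * (2 * Real.pi), y) = ch p (x, y) := by
  unfold ch
  rw [Complex.exp_eq_exp_iff_exists_int]
  refine ⟨n * p.1, ?_⟩
  push_cast
  ring

lemma ch_per2 (p : ℤ × ℤ) (x y : ℝ) (n : ℤ) : ch p (x, y + n * (2 * Real.pi)) = ch p (x, y) := by
  unfold ch
  rw [Complex.exp_eq_exp_iff_exists_int]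
  refine ⟨n * p.2, ?_⟩
  push_cast
  ring

lemma ch_mul_conj (p q : ℤ × ℤ) (k : ℝ × ℝ) : ch p k * (starRingEnd ℂ) (ch q k) = ch (p - q) k := by
  unfold ch
  rw [← Complex.exp_conj, ← Complex.exp_add]
  congr 1
  simp
  ring

lemma int_exp (m : ℤ) : ∫ x in Ico (-Real.pi) Real.pi, Complex.exp (Complex.I * ((x : ℂ) * (m : ℂ)))
    = if m = 0 then 2 * (Real.pi : ℂ) else 0 := by
  rw [integral_Ico_eq_integral_Ioo, ← integral_Ioc_eq_integral_Ioo,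
    ← intervalIntegral.integral_of_le (by linarith [Real.pi_pos])]
  split_ifs with h
  · simp [h]
    ring
  · have hc : Complex.I * (m : ℂ) ≠ 0 := by simp [h]
    have e : ∀ x : ℝ, Complex.I * ((x : ℂ) * (m : ℂ)) = (Complex.I * m) * x := fun x => by ring
    simp_rw [e]
    rw [integral_exp_mul_complex hc]
    have : Complex.exp (Complex.I * m * (Real.pi : ℝ)) =
        Complex.exp (Complex.I * m * ((-Real.pi : ℝ) : ℂ)) := by
      rw [Complex.exp_eq_exp_iff_exists_int]
      refine ⟨m, ?_⟩
      push_cast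
      ring
    rw [this, sub_self, zero_div]

lemma int_ch (p : ℤ × ℤ) : ∫ k in T2, ch p k = if p = 0 then 4 * (Real.pi : ℂ) ^ 2 else 0 := by
  have e : ∀ k : ℝ × ℝ, ch p k = Complex.exp (Complex.I * ((k.1 : ℂ) * (p.1 : ℂ))) *
      Complex.exp (Complex.I * ((k.2 : ℂ) * (p.2 : ℂ))) := fun k => by
    unfold ch
    rw [← Complex.exp_add]
    congr 1
    ring
  simp_rw [e]
  unfold T2
  rw [Measure.volume_eq_prod, setIntegral_prod_mul
    (fun x : ℝ => Complex.exp (Complex.I * ((x : ℂ) * (p.1 : ℂ))))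
    (fun x : ℝ => Complex.exp (Complex.I * ((x : ℂ) * (p.2 : ℂ)))), int_exp, int_exp]
  by_cases h1 : p.1 = 0 <;> by_cases h2 : p.2 = 0 <;> simp [h1, h2, Prod.ext_iff]
  ring

lemma T2_fin : volume T2 ≠ ⊤ := by
  unfold T2
  rw [Measure.volume_eq_prod, Measure.prod_prod]
  exact ENNReal.mul_ne_top (by simp) (by simp)

lemma integrableOn_T2 {E : Type*} [NormedAddCommGroup E] (f : ℝ × ℝ → E)
    (hf : Continuous f) : IntegrableOn f T2 := by
  have : IntegrableOn f (Icc (-Real.pi) Real.pi ×ˢ Icc (-Real.pi) Real.pi) :=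
    hf.continuousOn.integrableOn_compact (isCompact_Icc.prod isCompact_Icc)
  exact this.mono_set (prod_mono Ico_subset_Icc_self Ico_subset_Icc_self)

/-- trigonometric polynomial -/
def Q (a : ℤ × ℤ → ℂ) (F : Finset (ℤ × ℤ)) (k : ℝ × ℝ) : ℂ := ∑ p ∈ F, a p * ch p k

lemma Q_cont (a : ℤ × ℤ → ℂ) (F : Finset (ℤ × ℤ)) : Continuous (Q a F) := by
  unfold Q
  have := ch_cont
  fun_prop

lemma parseval (a : ℤ × ℤ → ℂ) (F : Finset (ℤ × ℤ)) :
    ∫ k in T2, ‖Q a F k‖ ^ 2 = 4 * Real.pi ^ 2 * ∑ p ∈ F, ‖a p‖ ^ 2 := by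
  have e : ∀ k, ((‖Q a F k‖ ^ 2 : ℝ) : ℂ) =
      ∑ p ∈ F, ∑ q ∈ F, a p * (starRingEnd ℂ) (a q) * ch (p - q) k := fun k => by
    push_cast
    rw [← Complex.mul_conj']
    unfold Q
    rw [map_sum, Finset.sum_mul_sum]
    refine Finset.sum_congr rfl fun p _ => Finset.sum_congr rfl fun q _ => ?_
    rw [← ch_mul_conj, map_mul]
    ring
  apply Complex.ofReal_injective
  rw [← integral_complex_ofReal]
  simp_rw [e]
  have hi : ∀ p q : ℤ × ℤ, IntegrableOn
      (fun k => a p * (starRingEnd ℂ) (a q) * ch (p - q) k) T2 := fun p q =>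
    integrableOn_T2 _ ((ch_cont _).const_mul _)
  rw [integral_finsetSum _ fun p _ => integrable_finsetSum _ fun q _ => hi p q]
  simp_rw [integral_finsetSum _ fun q _ => hi _ q, integral_const_mul, int_ch, sub_eq_zero]
  push_cast
  rw [Finset.mul_sum]
  refine Finset.sum_congr rfl fun p hp => ?_
  simp only [mul_ite, mul_zero, Finset.sum_ite_eq, hp, if_true]
  rw [Complex.mul_conj']
  ring

/-- Fourier series bound -/
lemma series_bound (a : ℤ × ℤ → ℂ) (B : ℝ) (hB : ∀ F : Finset (ℤ × ℤ), ∑ p ∈ F, ‖a p‖ ^ 2 ≤ B) :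
    ∫ k in T2, ‖(1 / (2 * (Real.pi : ℂ))) * ∑' p : ℤ × ℤ, a p * ch p k‖ ^ 2 ≤ B := by
  have hB0 : 0 ≤ B := by simpa using hB ∅
  have hpi := Real.pi_pos
  have hn : ∀ k p, ‖a p * ch p k‖ = ‖a p‖ := fun k p => by rw [norm_mul, ch_norm, mul_one]
  by_cases hs : Summable fun p => ‖a p‖
  · have hsk : ∀ k, Summable fun p => a p * ch p k := fun k =>
      Summable.of_norm (by simpa only [hn] using hs)
    have key : ∫ k in T2, ‖∑' p : ℤ × ℤ, a p * ch p k‖ ^ 2 ≤ 4 * Real.pi ^ 2 * B := by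
      have lim : Filter.Tendsto (fun F => ∫ k in T2, ‖Q a F k‖ ^ 2) Filter.atTop
          (nhds (∫ k in T2, ‖∑' p : ℤ × ℤ, a p * ch p k‖ ^ 2)) := by
        refine tendsto_integral_filter_of_dominated_convergence
          (fun _ => (∑' p, ‖a p‖) ^ 2) ?_ ?_ ?_ ?_
        · exact Filter.Eventually.of_forall fun F =>
            ((Q_cont a F).norm.pow 2).aestronglyMeasurable
        · refine Filter.Eventually.of_forall fun F => Filter.Eventually.of_forall fun k => ?_
          rw [Real.norm_of_nonneg (by positivity)]
          gcongr
          refine (norm_sum_le _ _).trans ?_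
          simp only [hn]
          exact hs.sum_le_tsum F fun _ _ => norm_nonneg _
        · exact integrableOn_const T2_fin
        · exact Filter.Eventually.of_forall fun k => ((hsk k).hasSum.norm).pow 2
      refine le_of_tendsto' lim fun F => ?_
      rw [parseval]
      gcongr
      exact hB F
    simp_rw [norm_mul, mul_pow]
    rw [integral_const_mul]
    have : ‖(1 / (2 * (Real.pi : ℂ)))‖ ^ 2 = (4 * Real.pi ^ 2)⁻¹ := by
      simp [abs_of_pos hpi]
      ring
    rw [this]
    calc _ ≤ (4 * Real.pi ^ 2)⁻¹ * (4 * Real.pi ^ 2 * B) := by gcongr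
      _ = B := by field_simp
  · have hsk : ∀ k, ¬ Summable fun p => a p * ch p k := fun k h => hs (by
      simpa only [hn] using h.norm)
    simp only [fun k => tsum_eq_zero_of_not_summable (hsk k)]
    simpa using hB0

def KK (s : ℝ) : ℝ := (K0 s * K0 s).toReal + 1

lemma KK_pos (s : ℝ) : 0 < KK s := by
  unfold KK
  positivity

lemma Q_weight {s : ℝ} (hs : 1 < s) (a : ℤ × ℤ → ℂ) (F : Finset (ℤ × ℤ)) {e : ℝ} (he : 0 < e)
    (he1 : e ≤ 1) :
    Integrable (fun x : ℝ × ℝ => (1 + x.1 ^ 2 + x.2 ^ 2) ^ (-s) * ‖Q a F (e * x.1, e ^ 2 * x.2)‖ ^ 2) ∧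
    ∫ x : ℝ × ℝ, (1 + x.1 ^ 2 + x.2 ^ 2) ^ (-s) * ‖Q a F (e * x.1, e ^ 2 * x.2)‖ ^ 2 ≤
      (e ^ 3)⁻¹ * KK s * (4 * Real.pi ^ 2 * ∑ p ∈ F, ‖a p‖ ^ 2) := by
  have hQ := Q_cont a F
  have hS : 0 ≤ ∑ p ∈ F, ‖a p‖ ^ 2 := Finset.sum_nonneg fun _ _ => by positivity
  have hfin : K0 s * K0 s ≠ ⊤ := ENNReal.mul_ne_top (K0_ne_top hs) (K0_ne_top hs)
  have hKK : K0 s * K0 s ≤ ENNReal.ofReal (KK s) := by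
    rw [← ENNReal.ofReal_toReal hfin]
    apply ENNReal.ofReal_le_ofReal
    unfold KK
    linarith
  have hK := (KK_pos s).le
  have h := two_dim hs (fun k => ENNReal.ofReal (‖Q a F k‖ ^ 2)) (by fun_prop)
    (fun x y n => by unfold Q; simp_rw [ch_per1]) (fun x y n => by unfold Q; simp_rw [ch_per2])
    he he1
  rw [← ofReal_integral_eq_lintegral_ofReal
    (integrableOn_T2 (fun k => ‖Q a F k‖ ^ 2) (by fun_prop))
    (Filter.Eventually.of_forall fun _ => by positivity), parseval] at h
  have h' : ∫⁻ x : ℝ × ℝ, ENNReal.ofReal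
      ((1 + x.1 ^ 2 + x.2 ^ 2) ^ (-s) * ‖Q a F (e * x.1, e ^ 2 * x.2)‖ ^ 2) ≤
      ENNReal.ofReal ((e ^ 3)⁻¹ * KK s * (4 * Real.pi ^ 2 * ∑ p ∈ F, ‖a p‖ ^ 2)) := by
    rw [ENNReal.ofReal_mul (by positivity), ENNReal.ofReal_mul (by positivity)]
    refine le_trans (le_of_eq ?_) (h.trans (by gcongr))
    refine lintegral_congr fun x => ?_
    rw [ENNReal.ofReal_mul (by positivity)]
  have hmeas : AEStronglyMeasurable (fun x : ℝ × ℝ =>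
      (1 + x.1 ^ 2 + x.2 ^ 2) ^ (-s) * ‖Q a F (e * x.1, e ^ 2 * x.2)‖ ^ 2) volume := by
    apply Measurable.aestronglyMeasurable
    have := hQ.measurable
    fun_prop
  constructor
  · refine ⟨hmeas, ?_⟩
    rw [hasFiniteIntegral_iff_ofReal (Filter.Eventually.of_forall fun _ => by positivity)]
    exact h'.trans_lt ENNReal.ofReal_lt_top
  · rw [integral_eq_lintegral_of_nonneg_ae (Filter.Eventually.of_forall fun _ => by positivity) hmeas]
    exact ENNReal.toReal_le_of_le_ofReal (by positivity) h'

lemma core {s : ℝ} (hs : 1 < s) (g : ℝ × ℝ → ℂ) (hg : Integrable g) (hH : MemHs s g)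
    {e : ℝ} (he : 0 < e) (he1 : e ≤ 1) (t : ℝ) (a : ℤ × ℤ → ℂ)
    (ha : ∀ p : ℤ × ℤ, a p = (1 / (2 * (Real.pi : ℂ))) * ∫ ξ : ℝ × ℝ, g ξ *
      Complex.exp (-(Complex.I * ((ξ.1 : ℂ) * ((e * ((p.1 : ℝ) - t) : ℝ) : ℂ) +
        (ξ.2 : ℂ) * ((e ^ 2 * (p.2 : ℝ) : ℝ) : ℂ)))))
    (F : Finset (ℤ × ℤ)) :
    ∑ p ∈ F, ‖a p‖ ^ 2 ≤ KK s * (e ^ 3)⁻¹ *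
      ∫ ξ : ℝ × ℝ, (1 + ξ.1 ^ 2 + ξ.2 ^ 2) ^ s * ‖g ξ‖ ^ 2 := by
  have hpi := Real.pi_pos
  have hKp := KK_pos s
  set S := ∑ p ∈ F, ‖a p‖ ^ 2 with hSdef
  set N := ∫ ξ : ℝ × ℝ, (1 + ξ.1 ^ 2 + ξ.2 ^ 2) ^ s * ‖g ξ‖ ^ 2 with hN
  have hS : 0 ≤ S := Finset.sum_nonneg fun _ _ => by positivity
  obtain ⟨hQi, hQb⟩ := Q_weight hs a F he he1
  rw [← hSdef] at hQb
  set E : ℤ × ℤ → ℝ × ℝ → ℂ := fun p ξ =>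
      Complex.exp (-(Complex.I * ((ξ.1 : ℂ) * ((e * ((p.1 : ℝ) - t) : ℝ) : ℂ) +
        (ξ.2 : ℂ) * ((e ^ 2 * (p.2 : ℝ) : ℝ) : ℂ)))) with hE
  have hEeq : ∀ p ξ, E p ξ = Complex.exp ((ξ.1 * e * t : ℝ) * Complex.I) *
      (starRingEnd ℂ) (ch p (e * ξ.1, e ^ 2 * ξ.2)) := fun p ξ => by
    simp only [hE]
    unfold ch
    rw [← Complex.exp_conj, ← Complex.exp_add]
    congr 1
    simp
    ring
  have hEn : ∀ p ξ, ‖E p ξ‖ = 1 := fun p ξ => by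
    rw [hEeq, norm_mul, Complex.norm_exp_ofReal_mul_I, RCLike.norm_conj, ch_norm, mul_one]
  have hEc : ∀ p, Continuous (E p) := fun p => by
    simp only [hE]
    fun_prop
  have hgi : ∀ p, Integrable fun ξ => g ξ * E p ξ := fun p =>
    hg.mul_bdd (c := 1) (hEc p).aestronglyMeasurable (Filter.Eventually.of_forall fun ξ => (hEn p ξ).le)
  have h1 : ((2 * Real.pi * S : ℝ) : ℂ) =
      ∫ ξ, ∑ p ∈ F, (starRingEnd ℂ) (a p) * (g ξ * E p ξ) := by
    rw [integral_finsetSum _ fun p _ => (hgi p).const_mul _]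
    simp_rw [integral_const_mul]
    have h2 : ∀ p, ∫ ξ, g ξ * E p ξ = 2 * Real.pi * a p := fun p => by
      rw [ha p]
      have : (Real.pi : ℂ) ≠ 0 := by exact_mod_cast hpi.ne'
      field_simp
      rfl
    simp_rw [h2]
    rw [hSdef]
    push_cast
    rw [Finset.mul_sum]
    refine Finset.sum_congr rfl fun p _ => ?_
    rw [← Complex.conj_mul']
    ring
  set lam : ℝ := 2 * Real.pi * KK s * (e ^ 3)⁻¹ with hlam
  have hlp : 0 < lam := by positivity
  have h3 : 2 * Real.pi * S ≤ ∫ ξ : ℝ × ℝ, (lam / 2 * ((1 + ξ.1 ^ 2 + ξ.2 ^ 2) ^ s * ‖g ξ‖ ^ 2) +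
      lam⁻¹ / 2 * ((1 + ξ.1 ^ 2 + ξ.2 ^ 2) ^ (-s) * ‖Q a F (e * ξ.1, e ^ 2 * ξ.2)‖ ^ 2)) := by
    have h4 : 2 * Real.pi * S = ‖((2 * Real.pi * S : ℝ) : ℂ)‖ := by
      rw [Complex.norm_real, Real.norm_of_nonneg (by positivity)]
    rw [h4, h1]
    refine norm_integral_le_of_norm_le ((hH.const_mul _).add (hQi.const_mul _))
      (Filter.Eventually.of_forall fun ξ => ?_)
    have h5 : ∑ p ∈ F, (starRingEnd ℂ) (a p) * (g ξ * E p ξ) =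
        g ξ * Complex.exp ((ξ.1 * e * t : ℝ) * Complex.I) *
          (starRingEnd ℂ) (Q a F (e * ξ.1, e ^ 2 * ξ.2)) := by
      unfold Q
      rw [map_sum, Finset.mul_sum]
      refine Finset.sum_congr rfl fun p _ => ?_
      rw [hEeq, map_mul]
      ring
    rw [h5, norm_mul, norm_mul, Complex.norm_exp_ofReal_mul_I, RCLike.norm_conj, mul_one]
    have hw : (0 : ℝ) < 1 + ξ.1 ^ 2 + ξ.2 ^ 2 := by positivity
    rw [Real.rpow_neg hw.le]
    have hW : 0 < (1 + ξ.1 ^ 2 + ξ.2 ^ 2) ^ s := Real.rpow_pos_of_pos hw _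
    generalize (1 + ξ.1 ^ 2 + ξ.2 ^ 2) ^ s = W at hW
    generalize ‖g ξ‖ = u
    generalize ‖Q a F (e * ξ.1, e ^ 2 * ξ.2)‖ = v
    have hWl : 0 < lam * W := by positivity
    have : lam / 2 * (W * u ^ 2) + lam⁻¹ / 2 * (W⁻¹ * v ^ 2) - u * v =
        (lam * W * u - v) ^ 2 / (2 * (lam * W)) := by
      field_simp
      ring
    have h6 : 0 ≤ (lam * W * u - v) ^ 2 / (2 * (lam * W)) := by positivity
    linarith
  rw [integral_add (hH.const_mul _) (hQi.const_mul _), integral_const_mul, integral_const_mul,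
    ← hN] at h3
  have h7 : lam⁻¹ / 2 * ((e ^ 3)⁻¹ * KK s * (4 * Real.pi ^ 2 * S)) = Real.pi * S := by
    rw [hlam]
    field_simp
    ring
  have h8 := mul_le_mul_of_nonneg_left hQb (by positivity : 0 ≤ lam⁻¹ / 2)
  rw [h7] at h8
  have h9 : Real.pi * S ≤ Real.pi * (KK s * (e ^ 3)⁻¹ * N) := by
    have : lam / 2 * N = Real.pi * (KK s * (e ^ 3)⁻¹ * N) := by
      rw [hlam]
      ring
    linarith
  exact le_of_mul_le_mul_left h9 hpi

/-- **Sampling estimate.**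
Let `s > 1` and `A ∈ C⁰([-τ₀, τ₀], Hˢ(ℝ²))`, realized as the inverse Fourier transform of
`Â`. Sampling `a_{m,n}(t) = A(ε(m - t), ε² n, ε³ t)` satisfies
`‖a(t)‖_{ℓ²(ℤ²)} ≤ C_s ε^{-3/2} ‖A(·,·,ε³t)‖_{Hˢ(ℝ²)}`, and consequently the Fourier
series `â` of `a` satisfies `‖â(·,·,t)‖_{L²(𝕋²)} ≤ C_s ε^{-3/2} ‖⟨·⟩ˢ Â(·,·,ε³t)‖_{L²(ℝ²)}`,
with a constant `C_s` depending only on `s`. -/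
theorem sampling_estimate (s : ℝ) (hs : 1 < s) :
    ∃ C > (0 : ℝ), ∀ (τ₀ : ℝ), 0 < τ₀ → ∀ (A : ℝ × ℝ → ℝ → ℂ) (Ahat : ℝ × ℝ → ℝ → ℂ),
      (∀ T ∈ Icc (-τ₀) τ₀, Integrable fun ξ : ℝ × ℝ => Ahat ξ T) →
      (∀ x : ℝ × ℝ, ∀ T ∈ Icc (-τ₀) τ₀,
        A x T = (1 / (2 * (Real.pi : ℂ))) * ∫ ξ : ℝ × ℝ, Ahat ξ T *
          Complex.exp (-(Complex.I * ((ξ.1 : ℂ) * (x.1 : ℂ) + (ξ.2 : ℂ) * (x.2 : ℂ))))) →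
      ContInHsOn s (Icc (-τ₀) τ₀) Ahat →
      ∀ ε ∈ Ioc (0 : ℝ) 1, ∀ t : ℝ, |t| ≤ τ₀ / ε ^ 3 →
        l2Z (fun p : ℤ × ℤ =>
            A (ε * ((p.1 : ℝ) - t), ε ^ 2 * (p.2 : ℝ)) (ε ^ 3 * t)) ≤
          C * ε ^ (-(3 : ℝ) / 2) * wL2 s (fun ξ => Ahat ξ (ε ^ 3 * t)) ∧
        (∫ k in T2, ‖(1 / (2 * (Real.pi : ℂ))) * ∑' p : ℤ × ℤ,
              A (ε * ((p.1 : ℝ) - t), ε ^ 2 * (p.2 : ℝ)) (ε ^ 3 * t) *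
                Complex.exp (Complex.I * ((k.1 : ℂ) * (p.1 : ℂ) + (k.2 : ℂ) * (p.2 : ℂ)))‖ ^ 2)
            ^ ((1 : ℝ) / 2) ≤
          C * ε ^ (-(3 : ℝ) / 2) * wL2 s (fun ξ => Ahat ξ (ε ^ 3 * t)) := by
  have hpi := Real.pi_pos
  refine ⟨(KK s) ^ ((1 : ℝ) / 2), Real.rpow_pos_of_pos (KK_pos s) _, ?_⟩
  intro τ₀ hτ A Ahat hint hA hcont ε hε t ht
  have hε0 : 0 < ε := hε.1
  have hT : ε ^ 3 * t ∈ Icc (-τ₀) τ₀ := by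
    rw [mem_Icc, ← abs_le, abs_mul, abs_of_pos (by positivity)]
    rwa [le_div_iff₀' (by positivity)] at ht
  have hb := core hs (fun ξ => Ahat ξ (ε ^ 3 * t)) (hint _ hT) (hcont.1 _ hT) hε0 hε.2 t
    (fun p : ℤ × ℤ => A (ε * ((p.1 : ℝ) - t), ε ^ 2 * (p.2 : ℝ)) (ε ^ 3 * t))
    (fun p => hA _ _ hT)
  have hN : 0 ≤ ∫ ξ : ℝ × ℝ, (1 + ξ.1 ^ 2 + ξ.2 ^ 2) ^ s * ‖Ahat ξ (ε ^ 3 * t)‖ ^ 2 :=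
    integral_nonneg fun ξ => by positivity
  have hR : (KK s) ^ ((1 : ℝ) / 2) * ε ^ (-(3 : ℝ) / 2) * wL2 s (fun ξ => Ahat ξ (ε ^ 3 * t)) =
      (KK s * (ε ^ 3)⁻¹ * ∫ ξ : ℝ × ℝ, (1 + ξ.1 ^ 2 + ξ.2 ^ 2) ^ s *
        ‖Ahat ξ (ε ^ 3 * t)‖ ^ 2) ^ ((1 : ℝ) / 2) := by
    have hK := (KK_pos s).le
    rw [Real.mul_rpow (by positivity) hN, Real.mul_rpow hK (by positivity)]
    unfold wL2
    congr 2
    rw [← Real.rpow_natCast, ← Real.rpow_neg hε0.le, ← Real.rpow_mul hε0.le]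
    congr 1
    norm_num
  rw [hR]
  constructor
  · unfold l2Z
    refine Real.rpow_le_rpow (tsum_nonneg fun _ => by positivity) ?_ (by norm_num)
    exact Real.tsum_le_of_sum_le (fun _ => by positivity) hb
  · refine Real.rpow_le_rpow (integral_nonneg fun _ => by positivity) ?_ (by norm_num)
    exact series_bound _ _ hb
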